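/- arXiv:2509.21969 — 8 statements merged into one kernel-verified Lean document; each statement's English description precedes it below -/
import Mathlib

section
/- Let 0 < p ≤ 1, let T ⊆ {1,…,n}, let x ∈ ℝⁿ be nonzero with x_i = 0 for all i ∉ T, and let v ∈ ℝⁿ be nonzero with x + v ≠ 0. Then ‖x+v‖_p^p / ‖x+v‖_2^p ≥ min{ ‖x‖_p^p / ‖x‖_2^p , (‖v‖_p^p − 2‖v_T‖_p^p) / ‖v‖_2^p }. -/
lemma aux_rpow_add {p : ℝ} (hp0 : 0 < p) (hp1 : p ≤ 1) {a b c : ℝ} (ha : 0 ≤ a) (hb : 0 ≤ b)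
    (hc : 0 ≤ c) (h : a ≤ b + c) : a ^ p ≤ b ^ p + c ^ p :=
  (Real.rpow_le_rpow ha h hp0.le).trans (Real.rpow_add_le_add_rpow hb hc hp0.le hp1)

lemma aux_norm {n : ℕ} (p : ℝ) (x : Fin n → ℝ) :
    (∑ i, (x i) ^ 2) ^ (p/2) = ‖(WithLp.toLp 2 x : EuclideanSpace ℝ (Fin n))‖ ^ p := by
  have h : ∑ i, (x i) ^ 2 = ‖(WithLp.toLp 2 x : EuclideanSpace ℝ (Fin n))‖ ^ (2:ℝ) := by
    rw [Real.rpow_two, EuclideanSpace.norm_sq_eq]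
    simp
  rw [h, ← Real.rpow_mul (norm_nonneg _)]
  congr 1
  ring

/-- For `0 < p ≤ 1`, `T ⊆ {1,…,n}`, `x ≠ 0` supported on `T`,
`v ≠ 0`, `x + v ≠ 0`:
`‖x+v‖_p^p / ‖x+v‖_2^p ≥ min( ‖x‖_p^p / ‖x‖_2^p , (‖v‖_p^p − 2‖v_T‖_p^p) / ‖v‖_2^p )`. -/
theorem ratio_min_lower_bound (n : ℕ) (p : ℝ) (hp0 : 0 < p) (hp1 : p ≤ 1)
    (T : Finset (Fin n)) (x v : Fin n → ℝ) (hx : x ≠ 0) (hxT : ∀ i ∉ T, x i = 0)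
    (hv : v ≠ 0) (hxv : x + v ≠ 0) :
    min ((∑ i, |x i| ^ p) / (∑ i, (x i) ^ 2) ^ (p/2))
        (((∑ i, |v i| ^ p) - 2 * ∑ i ∈ T, |v i| ^ p) / (∑ i, (v i) ^ 2) ^ (p/2))
      ≤ (∑ i, |(x + v) i| ^ p) / (∑ i, ((x + v) i) ^ 2) ^ (p/2) := by
  have hpos : ∀ y : Fin n → ℝ, y ≠ 0 → 0 < (∑ i, (y i) ^ 2) ^ (p/2) := by
    intro y hy
    rw [aux_norm]
    apply Real.rpow_pos_of_pos
    rw [norm_pos_iff]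
    intro h
    apply hy
    simpa using h
  have ha := hpos x hx
  have hb := hpos v hv
  have hc := hpos _ hxv
  have htri : (∑ i, ((x + v) i) ^ 2) ^ (p/2)
      ≤ (∑ i, (x i) ^ 2) ^ (p/2) + (∑ i, (v i) ^ 2) ^ (p/2) := by
    simp only [aux_norm]
    refine aux_rpow_add hp0 hp1 (norm_nonneg _) (norm_nonneg _) (norm_nonneg _) ?_
    rw [WithLp.toLp_add]
    exact norm_add_le _ _
  have hnum : (∑ i, |x i| ^ p) + ((∑ i, |v i| ^ p) - 2 * ∑ i ∈ T, |v i| ^ p)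
      ≤ ∑ i, |(x + v) i| ^ p := by
    have hT : ∑ i ∈ T, |v i| ^ p = ∑ i, if i ∈ T then |v i| ^ p else 0 := by
      simp
    rw [hT, Finset.mul_sum, ← Finset.sum_sub_distrib, ← Finset.sum_add_distrib]
    apply Finset.sum_le_sum
    intro i _
    by_cases hi : i ∈ T
    · have := aux_rpow_add hp0 hp1 (abs_nonneg (x i)) (abs_nonneg (x i + v i))
        (abs_nonneg (v i)) (by simpa using abs_sub (x i + v i) (v i))
      simp only [hi, if_true, Pi.add_apply]
      linarith
    · simp [hi, hxT i hi, Real.zero_rpow hp0.ne']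
  have hS : 0 ≤ ∑ i, |(x + v) i| ^ p :=
    Finset.sum_nonneg fun i _ => Real.rpow_nonneg (abs_nonneg _) _
  generalize (∑ i, (x i) ^ 2) ^ (p/2) = a at *
  generalize (∑ i, (v i) ^ 2) ^ (p/2) = b at *
  generalize (∑ i, ((x + v) i) ^ 2) ^ (p/2) = c at *
  generalize (∑ i, |(x + v) i| ^ p) = S at *
  generalize (∑ i, |v i| ^ p) - 2 * ∑ i ∈ T, |v i| ^ p = B at *
  generalize ∑ i, |x i| ^ p = A at *
  have h1 := (le_div_iff₀ ha).1 (min_le_left (A / a) (B / b))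
  have h2 := (le_div_iff₀ hb).1 (min_le_right (A / a) (B / b))
  generalize min (A / a) (B / b) = m at *
  rw [le_div_iff₀ hc]
  rcases le_total 0 m with hm | hm
  · nlinarith [mul_le_mul_of_nonneg_left htri hm]
  · exact (mul_nonpos_of_nonpos_of_nonneg hm hc.le).trans hS
end

section
/- Let 0 < p ≤ 1, s ≥ 1, and set c := 1/2 − (1/4)·s^{(p²−p)/2}. Let A be an m×n real matrix satisfying: (1) for every v ∈ ker(A)\{0} and every T ⊆ {1,…,n} with |T| ≤ s, (1−c)‖v_T‖_p^p ≤ c‖v_{T^c}‖_p^p; and (2) ‖v‖_p ≥ 2^{1/p} s^{1/p − p/2} ‖v‖_2 for every v ∈ ker(A)\{0}. Then for every b ∈ ℝ^m with b ≠ 0, every x ∈ ℝⁿ with at most s nonzero entries satisfying Ax = b, and every v ∈ ker(A), one has ‖x‖_p^p / ‖x‖_2^p ≤ ‖x+v‖_p^p / ‖x+v‖_2^p. -/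
lemma aux_E_add {n : ℕ} (p : ℝ) (hp0 : 0 < p) (hp1 : p ≤ 1) (x v : Fin n → ℝ) :
    (∑ i, ((x + v) i) ^ 2) ^ (p/2) ≤ (∑ i, (x i) ^ 2) ^ (p/2) + (∑ i, (v i) ^ 2) ^ (p/2) := by
  have key : ∀ y : Fin n → ℝ, (∑ i, (y i) ^ 2) ^ (p/2) = ‖WithLp.toLp 2 y‖ ^ p := by
    intro y
    rw [EuclideanSpace.norm_eq, Real.sqrt_eq_rpow, ← Real.rpow_mul (by positivity)]
    simp only [Real.norm_eq_abs, sq_abs]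
    congr 1; ring
  rw [key, key, key, WithLp.toLp_add]
  refine (Real.rpow_le_rpow (norm_nonneg _) (norm_add_le _ _) hp0.le).trans ?_
  exact Real.rpow_add_le_add_rpow (norm_nonneg _) (norm_nonneg _) hp0.le hp1

lemma aux_N_le {n : ℕ} (s : ℕ) (p : ℝ) (hp0 : 0 < p) (hp1 : p ≤ 1) (x : Fin n → ℝ)
    (S : Finset (Fin n)) (hS : S.card ≤ s) (hx : ∀ i, i ∉ S → x i = 0) :
    ∑ i, |x i| ^ p ≤ (s : ℝ) ^ (1 - p/2) * (∑ i, (x i) ^ 2) ^ (p/2) := by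
  have h1 : ∑ i, |x i| ^ p = ∑ i ∈ S, |x i| ^ p := by
    symm
    apply Finset.sum_subset (Finset.subset_univ _)
    intro i _ hi
    simp [hx i hi, Real.zero_rpow hp0.ne']
  have hpq : (2/p).HolderConjugate (2/(2-p)) := by
    have : (2 - p) ≠ 0 := by linarith
    rw [Real.holderConjugate_iff]
    constructor
    · rw [lt_div_iff₀ hp0]; linarith
    · field_simp; ring
  have h2 := Real.inner_le_Lp_mul_Lq S (fun i => |x i| ^ p) (fun _ => 1) hpq
  have h3 : ∀ i, |(|x i| ^ p)| ^ (2/p) = (x i)^2 := by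
    intro i
    rw [abs_of_nonneg (by positivity), ← Real.rpow_mul (abs_nonneg _)]
    have : p * (2/p) = 2 := by field_simp
    rw [this]; simp
  simp only [h3, mul_one, abs_one, Real.one_rpow, Finset.sum_const, nsmul_eq_mul, one_div_div] at h2
  rw [h1]
  refine h2.trans ?_
  rw [mul_comm]
  have : (2 - p)/2 = 1 - p/2 := by ring
  rw [this]
  have h4 : (0:ℝ) ≤ 1 - p/2 := by linarith
  gcongr
  exact Finset.subset_univ _

lemma aux_N_add {n : ℕ} (p : ℝ) (hp0 : 0 < p) (hp1 : p ≤ 1) (x v : Fin n → ℝ)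
    (S : Finset (Fin n)) (hx : ∀ i, i ∉ S → x i = 0) :
    ∑ i, |x i| ^ p + ∑ i ∈ Sᶜ, |v i| ^ p ≤ ∑ i, |(x + v) i| ^ p + ∑ i ∈ S, |v i| ^ p := by
  have h1 := Finset.sum_add_sum_compl S (fun i => |x i| ^ p)
  have h2 := Finset.sum_add_sum_compl S (fun i => |(x + v) i| ^ p)
  have h3 : ∑ i ∈ Sᶜ, |x i| ^ p = 0 := by
    apply Finset.sum_eq_zero
    intro i hi
    simp [hx i (by simpa using hi), Real.zero_rpow hp0.ne']
  have h4 : ∑ i ∈ Sᶜ, |(x + v) i| ^ p = ∑ i ∈ Sᶜ, |v i| ^ p := by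
    apply Finset.sum_congr rfl
    intro i hi
    simp [hx i (by simpa using hi)]
  have h5 : ∑ i ∈ S, |x i| ^ p ≤ ∑ i ∈ S, |(x + v) i| ^ p + ∑ i ∈ S, |v i| ^ p := by
    rw [← Finset.sum_add_distrib]
    apply Finset.sum_le_sum
    intro i _
    refine le_trans ?_ (Real.rpow_add_le_add_rpow (abs_nonneg _) (abs_nonneg _) hp0.le hp1)
    apply Real.rpow_le_rpow (abs_nonneg _) _ hp0.le
    have := abs_sub ((x + v) i) (v i)
    simpa using this
  linarith

/-- Exact recovery under the extended null space property (eNSP).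
If `A` satisfies the eNSP of order `s` with constant `c = 1/2 − (1/4) s^{(p²−p)/2}` and
`‖v‖_p ≥ 2^{1/p} s^{1/p − p/2} ‖v‖_2` for all nonzero `v ∈ ker A`, then for every
`b ≠ 0`, every `s`-sparse solution `x` of `Ax = b`, and every `v ∈ ker A`:
`‖x‖_p^p / ‖x‖_2^p ≤ ‖x+v‖_p^p / ‖x+v‖_2^p`. -/
theorem eNSP_exact_recovery (m n s : ℕ) (hs : 1 ≤ s) (p : ℝ) (hp0 : 0 < p) (hp1 : p ≤ 1)
    (A : Matrix (Fin m) (Fin n) ℝ) (c : ℝ)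
    (hc : c = 1/2 - (1/4) * (s : ℝ) ^ ((p ^ 2 - p)/2))
    (heNSP : ∀ v : Fin n → ℝ, A.mulVec v = 0 → v ≠ 0 →
      ∀ T : Finset (Fin n), T.card ≤ s →
        (1 - c) * ∑ i ∈ T, |v i| ^ p ≤ c * ∑ i ∈ Tᶜ, |v i| ^ p)
    (hinf : ∀ v : Fin n → ℝ, A.mulVec v = 0 → v ≠ 0 →
      (2 : ℝ) ^ (1/p) * (s : ℝ) ^ (1/p - p/2) * (∑ i, (v i) ^ 2) ^ ((1 : ℝ)/2)
        ≤ (∑ i, |v i| ^ p) ^ (1/p))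
    (b : Fin m → ℝ) (hb : b ≠ 0)
    (x : Fin n → ℝ) (hxs : {i | x i ≠ 0}.ncard ≤ s) (hAx : A.mulVec x = b)
    (v : Fin n → ℝ) (hv : A.mulVec v = 0) :
    (∑ i, |x i| ^ p) / (∑ i, (x i) ^ 2) ^ (p/2)
      ≤ (∑ i, |(x + v) i| ^ p) / (∑ i, ((x + v) i) ^ 2) ^ (p/2) := by
  classical
  have hs0 : (0:ℝ) < s := by exact_mod_cast hs
  by_cases hv0 : v = 0
  · simp [hv0]
  have hx0 : x ≠ 0 := by
    rintro rfl
    exact hb (by rw [← hAx]; simp)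
  have hxv0 : x + v ≠ 0 := by
    intro h
    apply hb
    have := congrArg A.mulVec h
    rw [Matrix.mulVec_add, hv, hAx] at this
    simpa using this
  have hpos : ∀ y : Fin n → ℝ, y ≠ 0 → 0 < (∑ i, (y i) ^ 2) ^ (p/2) := by
    intro y hy
    apply Real.rpow_pos_of_pos
    obtain ⟨i, hi⟩ := Function.ne_iff.mp hy
    exact Finset.sum_pos' (fun _ _ => sq_nonneg _) ⟨i, Finset.mem_univ _, by
      have : y i ≠ 0 := hi
      positivity⟩
  obtain ⟨S, hSdef⟩ : ∃ S : Finset (Fin n), S = Finset.univ.filter (fun i => x i ≠ 0) := ⟨_, rfl⟩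
  have hS : S.card ≤ s := by
    rw [← Set.ncard_coe_finset, hSdef]
    simpa using hxs
  have hxS : ∀ i, i ∉ S → x i = 0 := by
    intro i hi
    simpa [hSdef] using hi
  have h1 := aux_E_add p hp0 hp1 x v
  have h2 := aux_N_le s p hp0 hp1 x S hS hxS
  have h3 := aux_N_add p hp0 hp1 x v S hxS
  have h4 := heNSP v hv hv0 S hS
  have h5 := hinf v hv hv0
  have h6 := Finset.sum_add_sum_compl S (fun i => |v i| ^ p)
  have hEv := hpos v hv0
  have hEx := hpos x hx0
  have hExv := hpos _ hxv0
  -- raise the second hypothesis to the power `p`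
  have h7 : 2 * (s:ℝ) ^ (1 - p^2/2) * (∑ i, (v i) ^ 2) ^ (p/2) ≤ ∑ i, |v i| ^ p := by
    have hV : 0 ≤ ∑ i, |v i| ^ p := by positivity
    have hW : 0 ≤ ∑ i, (v i) ^ 2 := by positivity
    have := Real.rpow_le_rpow (by positivity) h5 hp0.le
    rw [← Real.rpow_mul hV, Real.mul_rpow (by positivity) (by positivity),
      Real.mul_rpow (by positivity) (by positivity), ← Real.rpow_mul (by norm_num),
      ← Real.rpow_mul hs0.le, ← Real.rpow_mul hW] at this
    have e1 : 1 / p * p = 1 := by field_simp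
    have e2 : (1 / p - p / 2) * p = 1 - p^2/2 := by field_simp
    have e3 : 1 / 2 * p = p / 2 := by ring
    rw [e1, e2, e3, Real.rpow_one, Real.rpow_one] at this
    exact this
  have h8 : (s:ℝ) ^ ((p^2-p)/2) * (s:ℝ) ^ (1 - p^2/2) = (s:ℝ) ^ (1 - p/2) := by
    rw [← Real.rpow_add hs0]
    congr 1; ring
  have hq : 0 < (s:ℝ) ^ ((p^2-p)/2) := by positivity
  have hN : 0 ≤ ∑ i, |x i| ^ p := by positivity
  rw [div_le_div_iff₀ hEx hExv]
  subst hc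
  generalize (s:ℝ) ^ ((p^2-p)/2) = q at *
  generalize (s:ℝ) ^ (1 - p^2/2) = r at *
  generalize (s:ℝ) ^ (1 - p/2) = t at *
  generalize (∑ i, ((x + v) i) ^ 2) ^ (p/2) = Exv at *
  generalize (∑ i, (x i) ^ 2) ^ (p/2) = Ex at *
  generalize (∑ i, (v i) ^ 2) ^ (p/2) = Ev at *
  generalize ∑ i, |(x + v) i| ^ p = Nxv at *
  generalize ∑ i, |x i| ^ p = Nx at *
  generalize ∑ i, |v i| ^ p = V at *
  have h9 : Nx + t * Ev ≤ Nxv := by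
    have a := mul_le_mul_of_nonneg_left h7 hq.le
    have b : q * (2 * r * Ev) = 2 * (t * Ev) := by rw [← h8]; ring
    rw [b] at a
    rw [← h6] at a
    linarith
  calc Nx * Exv ≤ Nx * (Ex + Ev) := by gcongr
    _ = Nx * Ex + Nx * Ev := by ring
    _ ≤ Nx * Ex + (t * Ex) * Ev := by gcongr
    _ = (Nx + t * Ev) * Ex := by ring
    _ ≤ Nxv * Ex := by gcongr
end

section
/- Let 0 < p ≤ 1, s ≥ 1, α ∈ (0,1), and let x, x* ∈ ℝⁿ be nonzero with x ≠ x*, satisfying ‖x‖_p^p ≤ s^{1−p/2}‖x‖_2^p and ‖x*‖_p^p ≤ s^{1−p/2}‖x*‖_2^p. If ⟨x, x*⟩ < (1 − 7α²/32)‖x‖_2‖x*‖_2, then ‖x* − x‖_p^p / ‖x* − x‖_2^p ≤ (2·5^p/α^p)·s^{1−p/2}. -/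
/-- Case 1 of the stable-recovery proof: if the angle condition is
violated, i.e. `⟨x, x*⟩ < (1 − 7α²/32)‖x‖₂‖x*‖₂`, and both `x, x*` have
`ℓ_p/ℓ_2` ratio at most `s^{1−p/2}`, then
`‖x* − x‖_p^p / ‖x* − x‖_2^p ≤ (2·5^p/α^p) s^{1−p/2}`. -/
theorem error_ratio_bound_angle_violation (n s : ℕ) (hs : 1 ≤ s) (p α : ℝ)
    (hp0 : 0 < p) (hp1 : p ≤ 1) (hα0 : 0 < α) (hα1 : α < 1)
    (x xs : Fin n → ℝ) (hx : x ≠ 0) (hxs : xs ≠ 0) (hne : x ≠ xs)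
    (hxrat : ∑ i, |x i| ^ p ≤ (s : ℝ) ^ (1 - p/2) * (∑ i, (x i) ^ 2) ^ (p/2))
    (hxsrat : ∑ i, |xs i| ^ p ≤ (s : ℝ) ^ (1 - p/2) * (∑ i, (xs i) ^ 2) ^ (p/2))
    (hang : ∑ i, x i * xs i <
      (1 - 7 * α ^ 2 / 32) * (∑ i, (x i) ^ 2) ^ ((1 : ℝ)/2) * (∑ i, (xs i) ^ 2) ^ ((1 : ℝ)/2)) :
    (∑ i, |xs i - x i| ^ p) / (∑ i, (xs i - x i) ^ 2) ^ (p/2)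
      ≤ (2 * (5 : ℝ) ^ p / α ^ p) * (s : ℝ) ^ (1 - p/2) := by
  have hA : 0 ≤ ∑ i, (x i) ^ 2 := Finset.sum_nonneg fun i _ => sq_nonneg _
  have hB : 0 ≤ ∑ i, (xs i) ^ 2 := Finset.sum_nonneg fun i _ => sq_nonneg _
  have hDe : ∑ i, (xs i - x i) ^ 2
      = ∑ i, (x i) ^ 2 + ∑ i, (xs i) ^ 2 - 2 * ∑ i, x i * xs i := by
    rw [Finset.mul_sum, ← Finset.sum_add_distrib, ← Finset.sum_sub_distrib]
    exact Finset.sum_congr rfl fun i _ => by ring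
  have hD : 0 < ∑ i, (xs i - x i) ^ 2 := by
    obtain ⟨i, hi⟩ := Function.ne_iff.mp hne
    refine Finset.sum_pos' (fun i _ => sq_nonneg _) ⟨i, Finset.mem_univ _, ?_⟩
    have : xs i - x i ≠ 0 := sub_ne_zero.mpr (Ne.symm hi)
    positivity
  have htri : ∑ i, |xs i - x i| ^ p ≤ ∑ i, |x i| ^ p + ∑ i, |xs i| ^ p := by
    rw [← Finset.sum_add_distrib]
    refine Finset.sum_le_sum fun i _ => ?_
    calc |xs i - x i| ^ p ≤ (|x i| + |xs i|) ^ p := by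
          refine Real.rpow_le_rpow (abs_nonneg _) ?_ hp0.le
          have := abs_sub (xs i) (x i)
          linarith
      _ ≤ _ := Real.rpow_add_le_add_rpow (abs_nonneg _) (abs_nonneg _) hp0.le hp1
  rw [← Real.sqrt_eq_rpow, ← Real.sqrt_eq_rpow] at hang
  generalize (∑ i, (x i) ^ 2) = A at *
  generalize (∑ i, (xs i) ^ 2) = B at *
  generalize (∑ i, (xs i - x i) ^ 2) = D at *
  generalize (∑ i, x i * xs i) = I at *
  have ha := Real.sq_sqrt hA
  have hb := Real.sq_sqrt hB
  generalize Real.sqrt A = a at *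
  generalize Real.sqrt B = b at *
  have hα2 : α ^ 2 ≤ 1 := by nlinarith
  have hc : α ^ 2 / 25 ≤ 1 - (1 - 7 * α ^ 2 / 32) ^ 2 := by
    nlinarith [mul_nonneg (sq_nonneg α) (sub_nonneg.mpr hα2)]
  have h1 : A ≤ (5 / α) ^ 2 * D := by
    have : α ^ 2 / 25 * A ≤ D := by
      have := mul_le_mul_of_nonneg_right hc hA
      nlinarith [sq_nonneg (b - (1 - 7 * α ^ 2 / 32) * a)]
    rw [div_pow, div_mul_eq_mul_div, le_div_iff₀ (by positivity)]
    linarith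
  have h2 : B ≤ (5 / α) ^ 2 * D := by
    have : α ^ 2 / 25 * B ≤ D := by
      have := mul_le_mul_of_nonneg_right hc hB
      nlinarith [sq_nonneg (a - (1 - 7 * α ^ 2 / 32) * b)]
    rw [div_pow, div_mul_eq_mul_div, le_div_iff₀ (by positivity)]
    linarith
  have hpow : ((5 / α) ^ 2 * D) ^ (p/2) = (5 : ℝ) ^ p / α ^ p * D ^ (p/2) := by
    rw [Real.mul_rpow (by positivity) hD.le, ← Real.rpow_natCast, ← Real.rpow_mul (by positivity),
      ← Real.div_rpow (by norm_num) hα0.le]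
    congr 2
    push_cast
    ring
  have h1' := Real.rpow_le_rpow hA h1 (by positivity : 0 ≤ p/2)
  have h2' := Real.rpow_le_rpow hB h2 (by positivity : 0 ≤ p/2)
  rw [hpow] at h1' h2'
  have hS : 0 ≤ (s : ℝ) ^ (1 - p/2) := by positivity
  rw [div_le_iff₀ (by positivity)]
  calc _ ≤ _ := htri
    _ ≤ _ := add_le_add hxrat hxsrat
    _ ≤ _ := add_le_add (mul_le_mul_of_nonneg_left h1' hS) (mul_le_mul_of_nonneg_left h2' hS)
    _ = _ := by ring
end

section
/- Let 0 < p ≤ 1 and s ≥ 1. Let x, x* ∈ ℝⁿ with x ≠ x*, let T := supp(x) satisfy |T| ≤ s, and suppose ‖x*‖_p^p < ‖x‖_p^p. Then ‖x*_{T^c}‖_p^p ≤ ‖(x* − x)_T‖_p^p, and consequently ‖x* − x‖_p^p / ‖x* − x‖_2^p ≤ 2^{2−p/2}·s^{1−p/2}. -/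
/-- Case 2(a) of the stable-recovery proof: with `T = supp(x)`,
`|T| ≤ s`, and `‖x*‖_p^p < ‖x‖_p^p`, one has
`‖x*_{T^c}‖_p^p ≤ ‖(x* − x)_T‖_p^p` and consequently
`‖x* − x‖_p^p / ‖x* − x‖_2^p ≤ 2^{2−p/2} s^{1−p/2}`. -/
theorem error_ratio_bound_pnorm_decrease (n s : ℕ) (hs : 1 ≤ s) (p : ℝ)
    (hp0 : 0 < p) (hp1 : p ≤ 1) (x xs : Fin n → ℝ) (hne : x ≠ xs)
    (T : Finset (Fin n)) (hT : ∀ i, i ∈ T ↔ x i ≠ 0) (hTcard : T.card ≤ s)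
    (hlt : ∑ i, |xs i| ^ p < ∑ i, |x i| ^ p) :
    (∑ i ∈ Tᶜ, |xs i| ^ p ≤ ∑ i ∈ T, |xs i - x i| ^ p) ∧
      (∑ i, |xs i - x i| ^ p) / (∑ i, (xs i - x i) ^ 2) ^ (p/2)
        ≤ (2 : ℝ) ^ (2 - p/2) * (s : ℝ) ^ (1 - p/2) := by
  have hA : ∑ i ∈ Tᶜ, |xs i| ^ p ≤ ∑ i ∈ T, |xs i - x i| ^ p := by
    have h1 : ∑ i, |x i| ^ p = ∑ i ∈ T, |x i| ^ p := by
      symm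
      apply Finset.sum_subset (Finset.subset_univ T)
      intro i _ hi
      have : x i = 0 := by
        by_contra h
        exact hi ((hT i).2 h)
      rw [this, abs_zero, Real.zero_rpow hp0.ne']
    have h2 : ∑ i ∈ T, |x i| ^ p ≤ ∑ i ∈ T, |xs i - x i| ^ p + ∑ i ∈ T, |xs i| ^ p := by
      rw [← Finset.sum_add_distrib]
      apply Finset.sum_le_sum
      intro i _
      have h3 : |x i| ≤ |xs i - x i| + |xs i| := by
        have := abs_sub_abs_le_abs_sub (x i) (xs i)
        rw [abs_sub_comm] at this
        linarith
      exact (Real.rpow_le_rpow (abs_nonneg _) h3 hp0.le).trans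
        (Real.rpow_add_le_add_rpow (abs_nonneg _) (abs_nonneg _) hp0.le hp1)
    have h4 := Finset.sum_add_sum_compl T (fun i => |xs i| ^ p)
    linarith
  refine ⟨hA, ?_⟩
  have hpos : 0 < ∑ i, (xs i - x i) ^ 2 := by
    obtain ⟨j, hj⟩ := Function.ne_iff.1 hne
    apply Finset.sum_pos' (fun i _ => sq_nonneg _)
    exact ⟨j, Finset.mem_univ j, by
      have : xs j - x j ≠ 0 := sub_ne_zero.2 (Ne.symm hj)
      positivity⟩
  rw [div_le_iff₀ (Real.rpow_pos_of_pos hpos _)]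
  have hB : ∑ i, |xs i - x i| ^ p ≤ 2 * ∑ i ∈ T, |xs i - x i| ^ p := by
    have h4 := Finset.sum_add_sum_compl T (fun i => |xs i - x i| ^ p)
    have h5 : ∑ i ∈ Tᶜ, |xs i - x i| ^ p = ∑ i ∈ Tᶜ, |xs i| ^ p := by
      apply Finset.sum_congr rfl
      intro i hi
      have : x i = 0 := by
        by_contra h
        exact (Finset.mem_compl.1 hi) ((hT i).2 h)
      rw [this, sub_zero]
    linarith
  have hS0 : 0 ≤ ∑ i ∈ T, |xs i - x i| ^ p :=
    Finset.sum_nonneg fun i _ => Real.rpow_nonneg (abs_nonneg _) _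
  have hq : 1 ≤ 2 / p := by rw [le_div_iff₀ hp0]; linarith
  have hs1 : (1:ℝ) ≤ s := by exact_mod_cast hs
  have hC : (∑ i ∈ T, |xs i - x i| ^ p) ^ (2 / p) ≤
      (s : ℝ) ^ (2 / p - 1) * ∑ i, (xs i - x i) ^ 2 := by
    have h := Real.rpow_sum_le_const_mul_sum_rpow T (fun i => |xs i - x i| ^ p) hq
    have e1 : ∀ i, |(|xs i - x i| ^ p)| = |xs i - x i| ^ p := fun i =>
      abs_of_nonneg (Real.rpow_nonneg (abs_nonneg _) _)
    have e2 : ∀ i, (|xs i - x i| ^ p) ^ (2 / p) = (xs i - x i) ^ 2 := fun i => by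
      rw [← Real.rpow_mul (abs_nonneg _), mul_div_cancel₀ _ hp0.ne', Real.rpow_two, sq_abs]
    simp only [e1, e2] at h
    refine h.trans ?_
    apply mul_le_mul
    · exact Real.rpow_le_rpow (Nat.cast_nonneg _) (by exact_mod_cast hTcard) (by linarith)
    · exact Finset.sum_le_sum_of_subset_of_nonneg (Finset.subset_univ T)
        (fun i _ _ => sq_nonneg _)
    · exact Finset.sum_nonneg fun i _ => sq_nonneg _
    · positivity
  have hD : ∑ i ∈ T, |xs i - x i| ^ p ≤
      (s : ℝ) ^ (1 - p / 2) * (∑ i, (xs i - x i) ^ 2) ^ (p / 2) := by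
    have h := Real.rpow_le_rpow (Real.rpow_nonneg hS0 _) hC (by linarith : 0 ≤ p / 2)
    rw [← Real.rpow_mul hS0, Real.mul_rpow (by positivity) hpos.le,
      ← Real.rpow_mul (by positivity)] at h
    have e3 : 2 / p * (p / 2) = 1 := by field_simp
    have e4 : (2 / p - 1) * (p / 2) = 1 - p / 2 := by rw [sub_mul, e3, one_mul]
    rwa [e3, e4, Real.rpow_one] at h
  have hE : (2:ℝ) ≤ 2 ^ (2 - p / 2) := by
    have := Real.rpow_le_rpow_of_exponent_le (x := (2:ℝ)) (by norm_num)
      (by linarith : (1:ℝ) ≤ 2 - p / 2)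
    rwa [Real.rpow_one] at this
  calc _ ≤ _ := hB
    _ ≤ (2:ℝ) ^ (2 - p / 2) * ((s : ℝ) ^ (1 - p / 2) * (∑ i, (xs i - x i) ^ 2) ^ (p / 2)) :=
        mul_le_mul hE hD hS0 (by positivity)
    _ = _ := by ring
end

section
/- Let 0 < p ≤ 1, s ≥ 1, α ∈ (0,1), and let x, x* ∈ ℝⁿ with x ≠ 0, satisfying ‖x‖_p^p ≤ s^{1−p/2}‖x‖_2^p, ‖x*‖_p^p ≤ s^{1−p/2}‖x*‖_2^p, and ‖x*‖_2 > (1 + α/4)‖x‖_2. Then ‖x* − x‖_p^p / ‖x* − x‖_2^p ≤ 2·((4+α)/α)^p·s^{1−p/2} ≤ (2·5^p/α^p)·s^{1−p/2}. -/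
/-- Case 2(b) of the stable-recovery proof: if
`‖x*‖₂ > (1 + α/4)‖x‖₂` and both `x, x*` have `ℓ_p/ℓ_2` ratio at most `s^{1−p/2}`,
then `‖x* − x‖_p^p / ‖x* − x‖_2^p ≤ 2((4+α)/α)^p s^{1−p/2} ≤ (2·5^p/α^p) s^{1−p/2}`. -/
theorem error_ratio_bound_norm_violation (n s : ℕ) (hs : 1 ≤ s) (p α : ℝ)
    (hp0 : 0 < p) (hp1 : p ≤ 1) (hα0 : 0 < α) (hα1 : α < 1)
    (x xs : Fin n → ℝ) (hx : x ≠ 0)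
    (hxrat : ∑ i, |x i| ^ p ≤ (s : ℝ) ^ (1 - p/2) * (∑ i, (x i) ^ 2) ^ (p/2))
    (hxsrat : ∑ i, |xs i| ^ p ≤ (s : ℝ) ^ (1 - p/2) * (∑ i, (xs i) ^ 2) ^ (p/2))
    (hnorm : (∑ i, (xs i) ^ 2) ^ ((1 : ℝ)/2) > (1 + α/4) * (∑ i, (x i) ^ 2) ^ ((1 : ℝ)/2)) :
    (∑ i, |xs i - x i| ^ p) / (∑ i, (xs i - x i) ^ 2) ^ (p/2)
        ≤ 2 * ((4 + α)/α) ^ p * (s : ℝ) ^ (1 - p/2) ∧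
      2 * ((4 + α)/α) ^ p * (s : ℝ) ^ (1 - p/2)
        ≤ (2 * (5 : ℝ) ^ p / α ^ p) * (s : ℝ) ^ (1 - p/2) := by
  have hS : (0 : ℝ) ≤ (s : ℝ) ^ (1 - p/2) := by positivity
  have key : ∀ y : Fin n → ℝ, (∑ i, (y i) ^ 2) ^ ((1 : ℝ)/2) = ‖WithLp.toLp 2 y‖ := by
    intro y
    rw [EuclideanSpace.norm_eq, Real.sqrt_eq_rpow]
    simp
  have keyp : ∀ y : Fin n → ℝ, (∑ i, (y i) ^ 2) ^ (p/2) = ‖WithLp.toLp 2 y‖ ^ p := by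
    intro y
    rw [← key y, ← Real.rpow_mul (Finset.sum_nonneg fun i _ => sq_nonneg (y i))]
    congr 1
    ring
  have hd := keyp (fun i => xs i - x i)
  have htri : ‖WithLp.toLp 2 xs‖ - ‖WithLp.toLp 2 x‖
      ≤ ‖WithLp.toLp 2 (fun i => xs i - x i)‖ :=
    norm_sub_norm_le (WithLp.toLp 2 xs) (WithLp.toLp 2 x)
  rw [key, key] at hnorm
  rw [keyp] at hxrat hxsrat
  rw [hd]
  have ha := norm_nonneg (WithLp.toLp 2 x)
  generalize ‖WithLp.toLp 2 x‖ = a at *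
  generalize ‖WithLp.toLp 2 xs‖ = b at *
  generalize ‖WithLp.toLp 2 (fun i => xs i - x i)‖ = d at *
  have hab : a ≤ b := by nlinarith
  have hb : 0 < b := by nlinarith
  have hdpos : 0 < d := by nlinarith
  have hbd : b ≤ (4 + α)/α * d := by
    rw [div_mul_eq_mul_div, le_div_iff₀ hα0]
    nlinarith
  have hnum : ∑ i, |xs i - x i| ^ p ≤ ∑ i, |xs i| ^ p + ∑ i, |x i| ^ p := by
    rw [← Finset.sum_add_distrib]
    refine Finset.sum_le_sum fun i _ => ?_
    exact (Real.rpow_le_rpow (abs_nonneg _) (abs_sub _ _) hp0.le).trans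
      (Real.rpow_add_le_add_rpow (abs_nonneg _) (abs_nonneg _) hp0.le hp1)
  have hap : a ^ p ≤ b ^ p := Real.rpow_le_rpow ha hab hp0.le
  have hbp : b ^ p ≤ ((4 + α)/α) ^ p * d ^ p := by
    rw [← Real.mul_rpow (by positivity) hdpos.le]
    exact Real.rpow_le_rpow hb.le hbd hp0.le
  constructor
  · rw [div_le_iff₀ (by positivity)]
    have h1 := mul_le_mul_of_nonneg_left hap hS
    have h2 := mul_le_mul_of_nonneg_left hbp hS
    nlinarith
  · refine mul_le_mul_of_nonneg_right ?_ hS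
    rw [mul_div_assoc, ← Real.div_rpow (by norm_num) hα0.le]
    gcongr
    linarith
end

section
/- Let A ∈ ℝ^{m×n}, b ∈ ℝ^m, and ζ > 0, and suppose Aᵀb ≠ 0 (i.e. b ∉ ker(Aᵀ)). Then there exist a nonzero vector ṽ ∈ ℝⁿ and a constant ε* > 0 such that for all ε ∈ (0, ε*), H(εṽ) < H(0), where H(x) := ζ‖x‖_{1/2}^{1/2}/‖x‖_2^{1/2} + ½‖Ax − b‖_2² for x ≠ 0 and H(0) := ζ + ½‖b‖_2². In particular, x = 0 is not a global minimizer of H. -/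
/-- The `ℓ_{1/2}/ℓ_2` regularized objective
`H(x) = ζ ‖x‖_{1/2}^{1/2}/‖x‖_2^{1/2} + ½‖Ax − b‖_2²`,
with the convention that the ratio equals `1` at `x = 0`, so `H(0) = ζ + ½‖b‖₂²`. -/
noncomputable def Hobj {m n : ℕ} (A : Matrix (Fin m) (Fin n) ℝ) (b : Fin m → ℝ)
    (ζ : ℝ) (x : Fin n → ℝ) : ℝ :=
  (if x = 0 then ζ
    else ζ * (∑ i, |x i| ^ ((1 : ℝ)/2)) / (∑ i, (x i) ^ 2) ^ ((1 : ℝ)/4))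
  + (1/2) * ∑ j, (A.mulVec x j - b j) ^ 2

/-- If `Aᵀb ≠ 0` then there exist a nonzero direction `ṽ` and `ε* > 0`
such that `H(εṽ) < H(0)` for all `ε ∈ (0, ε*)`; in particular `0` is not a global
minimizer of `H`. -/
theorem zero_not_minimizer (m n : ℕ) (A : Matrix (Fin m) (Fin n) ℝ) (b : Fin m → ℝ)
    (ζ : ℝ) (hζ : 0 < ζ) (hAb : A.transpose.mulVec b ≠ 0) :
    ∃ (v : Fin n → ℝ) (εs : ℝ), v ≠ 0 ∧ 0 < εs ∧
      ∀ ε : ℝ, 0 < ε → ε < εs → Hobj A b ζ (ε • v) < Hobj A b ζ 0 := by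
  obtain ⟨k, hk⟩ := Function.ne_iff.mp hAb
  set c : ℝ := A.transpose.mulVec b k with hc
  have hk0 : c ≠ 0 := hk
  have hcs : c = ∑ j, A j k * b j := rfl
  set S : ℝ := ∑ j, (A j k) ^ 2 with hS
  have hS0 : 0 ≤ S := Finset.sum_nonneg fun j _ => sq_nonneg _
  refine ⟨Pi.single k c, 2 / (S + 1), ?_, by positivity, ?_⟩
  · simpa using hk0
  intro ε hε hlt
  rw [lt_div_iff₀ (by positivity)] at hlt
  have hx : ε • (Pi.single k c : Fin n → ℝ) = Pi.single k (ε * c) := by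
    rw [← Pi.single_smul, smul_eq_mul]
  have ht : ε * c ≠ 0 := mul_ne_zero hε.ne' hk0
  rw [hx]
  set t : ℝ := ε * c with htd
  have h1 : ∑ i, |(Pi.single k t : Fin n → ℝ) i| ^ ((1 : ℝ)/2) = |t| ^ ((1 : ℝ)/2) := by
    rw [Finset.sum_eq_single k]
    · simp
    · intro i _ hi
      rw [Pi.single_eq_of_ne hi, abs_zero, Real.zero_rpow (by norm_num)]
    · simp
  have h2 : ∑ i, ((Pi.single k t : Fin n → ℝ) i) ^ 2 = t ^ 2 := by
    rw [Finset.sum_eq_single k]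
    · simp
    · intro i _ hi
      rw [Pi.single_eq_of_ne hi]; norm_num
    · simp
  have h3 : (t ^ 2) ^ ((1 : ℝ)/4) = |t| ^ ((1 : ℝ)/2) := by
    rw [← sq_abs, ← Real.rpow_natCast, ← Real.rpow_mul (abs_nonneg t)]
    norm_num
  have h4 : |t| ^ ((1 : ℝ)/2) ≠ 0 := (Real.rpow_pos_of_pos (abs_pos.mpr ht) _).ne'
  have h5 : (Pi.single k t : Fin n → ℝ) ≠ 0 := by simpa using ht
  have h6 : ∑ j, (A.mulVec (Pi.single k t) j - b j) ^ 2
      = t ^ 2 * S - 2 * t * c + ∑ j, b j ^ 2 := by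
    rw [hcs, hS, Finset.mul_sum, Finset.mul_sum, ← Finset.sum_sub_distrib,
      ← Finset.sum_add_distrib]
    refine Finset.sum_congr rfl fun j _ => ?_
    have : A.mulVec (Pi.single k t) j = A j k * t := by
      simp [Matrix.mulVec, dotProduct_single]
    rw [this]; ring
  have h7 : ∑ j, (A.mulVec 0 j - b j) ^ 2 = ∑ j, b j ^ 2 := by simp
  unfold Hobj
  rw [if_neg h5, if_pos rfl, h1, h2, h3, h6, h7, mul_div_assoc, div_self h4, mul_one]
  have h8 : 0 < ε * c ^ 2 := by positivity
  have h9 : t ^ 2 * S - 2 * t * c = -(ε * c ^ 2 * (2 - ε * S)) := by rw [htd]; ring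
  have h10 : 0 < ε * c ^ 2 * (2 - ε * S) := mul_pos h8 (by linarith)
  linarith
end

section
/- Let A ∈ ℝ^{m×n}, b ∈ ℝ^m, ζ > 0, ρ > 0, and let μ := λ_min(AᵀA), L_g := λ_max(AᵀA). Let (x, y, λ) ∈ ℝⁿ×ℝⁿ×ℝⁿ with λ = Aᵀ(Ay − b), and let (x⁺, y⁺, λ⁺) be obtained by one ADMM step: x⁺ is a global minimizer of x' ↦ Φ(x') + (ρ/2)‖x' − y + λ/ρ‖_2²; y⁺ is the minimizer of y' ↦ g(y') + (ρ/2)‖y' − x⁺ − λ/ρ‖_2²; λ⁺ = λ + ρ(x⁺ − y⁺). Then L_ρ(x⁺, y⁺, λ⁺) ≤ L_ρ(x, y, λ) − ((μ + ρ)/2 − L_g²/ρ)·‖y⁺ − y‖_2². In particular, if ρ > (−μ + √(μ² + 8L_g²))/2 then (μ+ρ)/2 − L_g²/ρ > 0 and the augmented Lagrangian does not increase along the ADMM iteration. -/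
/-- The set of (real) eigenvalues of a square matrix `M`. -/
def eigSet {n : ℕ} (M : Matrix (Fin n) (Fin n) ℝ) : Set ℝ :=
  {t : ℝ | ∃ v : Fin n → ℝ, v ≠ 0 ∧ M.mulVec v = t • v}

/-- `Φ(x) = ζ ‖x‖_{1/2}^{1/2}/‖x‖_2^{1/2}` for `x ≠ 0`, and `Φ(0) = ζ`. -/
noncomputable def Phi {n : ℕ} (ζ : ℝ) (x : Fin n → ℝ) : ℝ :=
  if x = 0 then ζ
  else ζ * (∑ i, |x i| ^ ((1 : ℝ)/2)) / (∑ i, (x i) ^ 2) ^ ((1 : ℝ)/4)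

/-- `g(y) = ½‖Ay − b‖₂²`. -/
noncomputable def gobj {m n : ℕ} (A : Matrix (Fin m) (Fin n) ℝ) (b : Fin m → ℝ)
    (y : Fin n → ℝ) : ℝ :=
  (1/2) * ∑ j, (A.mulVec y j - b j) ^ 2

/-- The augmented Lagrangian `L_ρ(x, y, λ) = Φ(x) + g(y) + ⟨λ, x − y⟩ + (ρ/2)‖x − y‖₂²`. -/
noncomputable def augLag {m n : ℕ} (A : Matrix (Fin m) (Fin n) ℝ) (b : Fin m → ℝ)
    (ζ ρ : ℝ) (x y lam : Fin n → ℝ) : ℝ :=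
  Phi ζ x + gobj A b y + (∑ i, lam i * (x i - y i)) + (ρ/2) * ∑ i, (x i - y i) ^ 2

open Matrix in
theorem aux_gobj_add {m n : ℕ} (A : Matrix (Fin m) (Fin n) ℝ) (b : Fin m → ℝ)
    (y w : Fin n → ℝ) :
    gobj A b (y + w) = gobj A b y + (A.transpose.mulVec (A.mulVec y - b)) ⬝ᵥ w
      + (1/2) * (A.mulVec w ⬝ᵥ A.mulVec w) := by
  have h : (A.transpose.mulVec (A.mulVec y - b)) ⬝ᵥ w
      = (A.mulVec y - b) ⬝ᵥ A.mulVec w := by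
    rw [Matrix.mulVec_transpose, Matrix.dotProduct_mulVec]
  rw [h]
  simp only [gobj, Matrix.mulVec_add, dotProduct, Pi.add_apply, Pi.sub_apply, Finset.mul_sum]
  rw [← Finset.sum_add_distrib, ← Finset.sum_add_distrib]
  exact Finset.sum_congr rfl fun i _ => by ring

theorem aux_sq {n : ℕ} {ρ : ℝ} (hρ : 0 < ρ) (u l : Fin n → ℝ) :
    (ρ/2) * ∑ i, (u i + l i / ρ) ^ 2
      = (ρ/2) * (u ⬝ᵥ u) + l ⬝ᵥ u + (1 / (2 * ρ)) * (l ⬝ᵥ l) := by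
  simp only [dotProduct, Finset.mul_sum]
  rw [← Finset.sum_add_distrib, ← Finset.sum_add_distrib]
  exact Finset.sum_congr rfl fun i _ => by field_simp; ring

theorem aux_sumsq {n : ℕ} (u : Fin n → ℝ) : u ⬝ᵥ u = ∑ i, (u i) ^ 2 := by
  simp only [dotProduct, sq]

theorem aux_gram {m n : ℕ} (A : Matrix (Fin m) (Fin n) ℝ) (u v : Fin n → ℝ) :
    (A.transpose * A).mulVec u ⬝ᵥ v = A.mulVec u ⬝ᵥ A.mulVec v := by
  rw [← Matrix.mulVec_mulVec, Matrix.mulVec_transpose, Matrix.dotProduct_mulVec]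

theorem aux_psd {n : ℕ} (N : Matrix (Fin n) (Fin n) ℝ) (hN : N.IsHermitian)
    (h : ∀ t ∈ eigSet N, 0 ≤ t) (v : Fin n → ℝ) : 0 ≤ N.mulVec v ⬝ᵥ v := by
  have hp : N.PosSemidef := by
    rw [hN.posSemidef_iff_eigenvalues_nonneg]
    intro i
    refine h _ ⟨(hN.eigenvectorBasis i : EuclideanSpace ℝ (Fin n)), ?_, hN.mulVec_eigenvectorBasis i⟩
    intro h0
    apply hN.eigenvectorBasis.orthonormal.ne_zero i
    ext j
    exact congrFun h0 j
  have := hp.dotProduct_mulVec_nonneg v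
  rw [dotProduct_comm]
  simpa using this

theorem aux_lower {m n : ℕ} (A : Matrix (Fin m) (Fin n) ℝ) (μ : ℝ)
    (hμ : IsLeast (eigSet (A.transpose * A)) μ) (d : Fin n → ℝ) :
    μ * (d ⬝ᵥ d) ≤ A.mulVec d ⬝ᵥ A.mulVec d := by
  have hM : (A.transpose * A).IsHermitian := Matrix.isHermitian_conjTranspose_mul_self A
  have := aux_psd (A.transpose * A - μ • (1 : Matrix (Fin n) (Fin n) ℝ))
    (by
      apply hM.sub
      simp [Matrix.IsHermitian])
    (by
      rintro t ⟨v, hv, h⟩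
      rw [Matrix.sub_mulVec, Matrix.smul_mulVec, Matrix.one_mulVec] at h
      have : μ ≤ t + μ := hμ.2 ⟨v, hv, by rw [add_smul, ← h]; simp⟩
      linarith) d
  rw [Matrix.sub_mulVec, Matrix.smul_mulVec, Matrix.one_mulVec, sub_dotProduct, aux_gram,
    smul_dotProduct, smul_eq_mul] at this
  linarith

theorem aux_upper {m n : ℕ} (A : Matrix (Fin m) (Fin n) ℝ) (L : ℝ)
    (hL : IsGreatest (eigSet (A.transpose * A)) L) (d : Fin n → ℝ) :
    A.mulVec d ⬝ᵥ A.mulVec d ≤ L * (d ⬝ᵥ d) := by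
  have hM : (A.transpose * A).IsHermitian := Matrix.isHermitian_conjTranspose_mul_self A
  have := aux_psd (L • (1 : Matrix (Fin n) (Fin n) ℝ) - A.transpose * A)
    (by
      refine Matrix.IsHermitian.sub ?_ hM
      simp [Matrix.IsHermitian])
    (by
      rintro t ⟨v, hv, h⟩
      rw [Matrix.sub_mulVec, Matrix.smul_mulVec, Matrix.one_mulVec] at h
      have : L - t ≤ L := hL.2 ⟨v, hv, by rw [sub_smul, ← h]; simp⟩
      linarith) d
  rw [Matrix.sub_mulVec, Matrix.smul_mulVec, Matrix.one_mulVec, sub_dotProduct, aux_gram,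
    smul_dotProduct, smul_eq_mul] at this
  linarith

theorem aux_nonneg {n : ℕ} (u : Fin n → ℝ) : 0 ≤ u ⬝ᵥ u := by
  rw [aux_sumsq]; positivity

theorem aux_upper_sq {m n : ℕ} (A : Matrix (Fin m) (Fin n) ℝ) (L : ℝ)
    (hL : IsGreatest (eigSet (A.transpose * A)) L) (d : Fin n → ℝ) :
    (A.transpose * A).mulVec d ⬝ᵥ (A.transpose * A).mulVec d ≤ L ^ 2 * (d ⬝ᵥ d) := by
  set e := (A.transpose * A).mulVec d with he
  have h1 := aux_upper A L hL d
  have h2 := aux_upper A L hL e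
  have h3 : e ⬝ᵥ e = A.mulVec d ⬝ᵥ A.mulVec e := by rw [he, aux_gram]
  have h4 : (A.mulVec d ⬝ᵥ A.mulVec e) ^ 2
      ≤ (A.mulVec d ⬝ᵥ A.mulVec d) * (A.mulVec e ⬝ᵥ A.mulVec e) := by
    rw [aux_sumsq, aux_sumsq]
    exact Finset.sum_mul_sq_le_sq_mul_sq _ _ _
  rw [← h3] at h4
  have h5 := mul_le_mul h1 h2 (aux_nonneg _) ((aux_nonneg _).trans h1)
  have h6 := aux_nonneg e
  rcases h6.eq_or_lt with h | h
  · rw [← h]; exact mul_nonneg (sq_nonneg _) (aux_nonneg _)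
  · refine le_of_mul_le_mul_right ?_ h
    nlinarith

/-- Sufficient descent of the augmented Lagrangian along one ADMM step,
where `μ = λ_min(AᵀA)`, `L_g = λ_max(AᵀA)` and `λ = Aᵀ(Ay − b)`:
`L_ρ(x⁺, y⁺, λ⁺) ≤ L_ρ(x, y, λ) − ((μ + ρ)/2 − L_g²/ρ)‖y⁺ − y‖₂²`; moreover the
constant is positive whenever `ρ > (−μ + √(μ² + 8L_g²))/2`. -/
theorem augLag_sufficient_descent (m n : ℕ) (A : Matrix (Fin m) (Fin n) ℝ)
    (b : Fin m → ℝ) (ζ ρ μ L : ℝ) (hζ : 0 < ζ) (hρ : 0 < ρ)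
    (hμ : IsLeast (eigSet (A.transpose * A)) μ)
    (hL : IsGreatest (eigSet (A.transpose * A)) L)
    (x y lam xp yp lamp : Fin n → ℝ)
    (hlam : lam = A.transpose.mulVec (A.mulVec y - b))
    (hxp : ∀ x' : Fin n → ℝ,
      Phi ζ xp + (ρ/2) * ∑ i, (xp i - y i + lam i / ρ) ^ 2
        ≤ Phi ζ x' + (ρ/2) * ∑ i, (x' i - y i + lam i / ρ) ^ 2)
    (hyp : ∀ y' : Fin n → ℝ,
      gobj A b yp + (ρ/2) * ∑ i, (yp i - xp i - lam i / ρ) ^ 2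
        ≤ gobj A b y' + (ρ/2) * ∑ i, (y' i - xp i - lam i / ρ) ^ 2)
    (hlamp : lamp = lam + ρ • (xp - yp)) :
    augLag A b ζ ρ xp yp lamp
        ≤ augLag A b ζ ρ x y lam - ((μ + ρ)/2 - L ^ 2 / ρ) * ∑ i, (yp i - y i) ^ 2 ∧
      (ρ > (-μ + Real.sqrt (μ ^ 2 + 8 * L ^ 2)) / 2 → 0 < (μ + ρ)/2 - L ^ 2 / ρ) := by
  have hfoc : A.transpose.mulVec (A.mulVec yp - b) = lam + ρ • (xp - yp) := by
    set w := A.transpose.mulVec (A.mulVec yp - b) - (lam + ρ • (xp - yp)) with hw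
    have hq : ∀ t : ℝ, 0 ≤ (1/2 * (A.mulVec w ⬝ᵥ A.mulVec w) + ρ/2 * (w ⬝ᵥ w)) * (t * t)
        + (w ⬝ᵥ w) * t + 0 := by
      intro t
      have h := hyp (yp + t • w)
      have e1 := aux_sq hρ (yp - xp) (-lam)
      have e2 := aux_sq hρ (yp + t • w - xp) (-lam)
      simp only [Pi.sub_apply, Pi.neg_apply, neg_div, ← sub_eq_add_neg] at e1 e2
      rw [e1, e2, aux_gobj_add] at h
      have e3 : w ⬝ᵥ w = A.transpose.mulVec (A.mulVec yp - b) ⬝ᵥ w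
          - (lam ⬝ᵥ w + ρ * ((xp - yp) ⬝ᵥ w)) := by
        conv_lhs => rw [hw]
        rw [← hw, sub_dotProduct, add_dotProduct, smul_dotProduct, smul_eq_mul]
      have e4 : yp + t • w - xp = t • w - (xp - yp) := by abel
      have e5 : yp - xp = - (xp - yp) := by abel
      rw [e4, e5] at h
      simp only [Matrix.mulVec_smul, smul_dotProduct, dotProduct_smul, sub_dotProduct,
        dotProduct_sub, neg_dotProduct, dotProduct_neg, smul_eq_mul] at h e3 ⊢
      simp only [dotProduct_comm w] at h e3 ⊢
      generalize A.transpose.mulVec (A.mulVec yp - b) ⬝ᵥ w = c at h e3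
      linear_combination h - t * e3
    have hd := discrim_le_zero hq
    have h0 : w ⬝ᵥ w = 0 := by
      unfold discrim at hd
      nlinarith
    exact sub_eq_zero.mp (dotProduct_self_eq_zero.mp h0)
  have hd0 : ∀ u v : Fin n → ℝ, ∑ i, (u i - v i) ^ 2 = (u - v) ⬝ᵥ (u - v) := by
    intro u v; rw [aux_sumsq]; rfl
  have hd1 : ∀ l u v : Fin n → ℝ, ∑ i, l i * (u i - v i) = l ⬝ᵥ (u - v) := fun _ _ _ => rfl
  constructor
  · simp only [augLag, hd0, hd1]
    obtain ⟨d, hd⟩ : ∃ d, d = yp - y := ⟨_, rfl⟩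
    obtain ⟨r, hr⟩ : ∃ r, r = xp - yp := ⟨_, rfl⟩
    have hyd : yp = y + d := by rw [hd]; abel
    have hxy : xp - y = r + d := by rw [hd, hr]; abel
    have hx := hxp x
    have e1 := aux_sq hρ (xp - y) lam
    have e2 := aux_sq hρ (x - y) lam
    simp only [Pi.sub_apply] at e1 e2
    rw [e1, e2, hxy] at hx
    have hMd : ρ • r = (A.transpose * A).mulVec d := by
      have : ρ • r = A.transpose.mulVec (A.mulVec yp - b) - lam := by rw [hfoc, hr]; abel
      rw [this, hlam, ← Matrix.mulVec_sub, ← Matrix.mulVec_mulVec, hd, Matrix.mulVec_sub A]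
      congr 1; abel
    have hlo := aux_lower A μ hμ d
    have hup := aux_upper_sq A L hL d
    have hg := aux_gram A d d
    rw [← hMd] at hup hg
    rw [hlamp, ← hr, ← hd]
    have hgo := aux_gobj_add A b y d
    rw [← hyd, ← hlam] at hgo
    rw [hgo]
    simp only [smul_dotProduct, dotProduct_smul, add_dotProduct, dotProduct_add, smul_eq_mul]
      at hup hg hx ⊢
    rw [dotProduct_comm d r] at hx
    have hup2 : ρ * (r ⬝ᵥ r) ≤ L ^ 2 / ρ * (d ⬝ᵥ d) := by
      rw [div_mul_eq_mul_div, le_div_iff₀ hρ]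
      linarith
    linarith
  · intro h
    have h1 : Real.sqrt (μ ^ 2 + 8 * L ^ 2) < 2 * ρ + μ := by linarith
    have h2 := Real.sq_sqrt (show 0 ≤ μ ^ 2 + 8 * L ^ 2 by positivity)
    have h3 := Real.sqrt_nonneg (μ ^ 2 + 8 * L ^ 2)
    have h4 : L ^ 2 / ρ < (μ + ρ) / 2 := by
      rw [div_lt_iff₀ hρ]
      nlinarith
    linarith
end

section
/- Let A ∈ ℝ^{m×n}, b ∈ ℝ^m, ζ > 0, ρ > 0. For all x, y ∈ ℝⁿ, the augmented Lagrangian evaluated at the multiplier λ = Aᵀ(Ay − b) satisfies the identity L_ρ(x, y, Aᵀ(Ay − b)) = Φ(x) + g(x) + (ρ/2)‖x − y‖_2² − ½‖A(x − y)‖_2²; consequently L_ρ(x, y, Aᵀ(Ay − b)) ≥ Φ(x) + g(x) + ((ρ − λ_max(AᵀA))/2)‖x − y‖_2², and in particular L_ρ(x, y, Aᵀ(Ay − b)) ≥ 0 whenever ρ ≥ λ_max(AᵀA). -/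
open Matrix in
lemma quad_le_eig {m n : ℕ} (A : Matrix (Fin m) (Fin n) ℝ) (L : ℝ)
    (hL : L ∈ upperBounds (eigSet (A.transpose * A))) (v : Fin n → ℝ) :
    ∑ j, (A.mulVec v j) ^ 2 ≤ L * ∑ i, v i ^ 2 := by
  have hM : (L • (1 : Matrix (Fin n) (Fin n) ℝ) - A.transpose * A).IsHermitian := by
    rw [Matrix.IsHermitian, Matrix.conjTranspose_eq_transpose_of_trivial]
    simp [Matrix.transpose_sub, Matrix.transpose_mul, Matrix.transpose_smul]
  have hP := hM.posSemidef_iff_eigenvalues_nonneg.2 (by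
    intro i
    have h := hM.mulVec_eigenvectorBasis i
    have h0 : (hM.eigenvectorBasis i) ≠ 0 := hM.eigenvectorBasis.orthonormal.ne_zero i
    have : L - hM.eigenvalues i ∈ eigSet (A.transpose * A) := by
      refine ⟨(hM.eigenvectorBasis i).ofLp, ?_, ?_⟩
      · intro h1
        exact h0 (by ext k; simpa using congrFun h1 k)
      · rw [Matrix.sub_mulVec, Matrix.smul_mulVec, Matrix.one_mulVec] at h
        rw [sub_smul, ← h]
        abel
    have := hL this
    simp only [Pi.zero_apply]
    linarith)
  have h := hP.dotProduct_mulVec_nonneg v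
  rw [Matrix.sub_mulVec, Matrix.smul_mulVec, Matrix.one_mulVec, dotProduct_sub,
    ← Matrix.mulVec_mulVec, Matrix.dotProduct_mulVec, Matrix.vecMul_transpose] at h
  rw [dotProduct_smul] at h
  simp only [star_trivial, smul_eq_mul, dotProduct, ← pow_two] at h
  linarith

lemma Phi_nonneg {n : ℕ} (ζ : ℝ) (hζ : 0 < ζ) (x : Fin n → ℝ) : 0 ≤ Phi ζ x := by
  unfold Phi
  split_ifs
  · exact hζ.le
  · positivity

/-- Lower bound for the augmented Lagrangian at `λ = Aᵀ(Ay − b)`: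
the identity `L_ρ(x, y, Aᵀ(Ay−b)) = Φ(x) + g(x) + (ρ/2)‖x−y‖₂² − ½‖A(x−y)‖₂²`,
the consequence `L_ρ ≥ Φ(x) + g(x) + ((ρ − λ_max(AᵀA))/2)‖x−y‖₂²`, and nonnegativity
whenever `ρ ≥ λ_max(AᵀA)`. -/
theorem augLag_lower_bound (m n : ℕ) (A : Matrix (Fin m) (Fin n) ℝ) (b : Fin m → ℝ)
    (ζ ρ L : ℝ) (hζ : 0 < ζ) (hρ : 0 < ρ)
    (hL : IsGreatest (eigSet (A.transpose * A)) L) (x y : Fin n → ℝ) :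
    augLag A b ζ ρ x y (A.transpose.mulVec (A.mulVec y - b))
        = Phi ζ x + gobj A b x + (ρ/2) * (∑ i, (x i - y i) ^ 2)
          - (1/2) * ∑ j, (A.mulVec (x - y) j) ^ 2 ∧
      Phi ζ x + gobj A b x + ((ρ - L)/2) * (∑ i, (x i - y i) ^ 2)
        ≤ augLag A b ζ ρ x y (A.transpose.mulVec (A.mulVec y - b)) ∧
      (L ≤ ρ → 0 ≤ augLag A b ζ ρ x y (A.transpose.mulVec (A.mulVec y - b))) := by
  have hid : augLag A b ζ ρ x y (A.transpose.mulVec (A.mulVec y - b))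
        = Phi ζ x + gobj A b x + (ρ/2) * (∑ i, (x i - y i) ^ 2)
          - (1/2) * ∑ j, (A.mulVec (x - y) j) ^ 2 := by
    have h1 : ∑ i, (A.transpose.mulVec (A.mulVec y - b)) i * (x i - y i)
        = ∑ j, (A.mulVec y j - b j) * (A.mulVec x j - A.mulVec y j) := by
      change (A.transpose.mulVec (A.mulVec y - b)) ⬝ᵥ (x - y) = _
      rw [Matrix.mulVec_transpose, ← Matrix.dotProduct_mulVec, Matrix.mulVec_sub]
      rfl
    have h2 : (1/2) * ∑ j, (A.mulVec y j - b j) ^ 2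
        + ∑ j, (A.mulVec y j - b j) * (A.mulVec x j - A.mulVec y j)
        = (1/2) * ∑ j, (A.mulVec x j - b j) ^ 2
          - (1/2) * ∑ j, (A.mulVec (x - y) j) ^ 2 := by
      rw [Matrix.mulVec_sub, Finset.mul_sum, Finset.mul_sum, Finset.mul_sum,
        ← Finset.sum_add_distrib, ← Finset.sum_sub_distrib]
      refine Finset.sum_congr rfl fun j _ => ?_
      simp only [Pi.sub_apply]
      ring
    unfold augLag gobj
    rw [h1]
    linarith
  have hq := quad_le_eig A L hL.2 (x - y)
  simp only [Pi.sub_apply] at hq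
  have hb : Phi ζ x + gobj A b x + ((ρ - L)/2) * (∑ i, (x i - y i) ^ 2)
        ≤ augLag A b ζ ρ x y (A.transpose.mulVec (A.mulVec y - b)) := by
    rw [hid]
    linarith
  refine ⟨hid, hb, fun h => le_trans ?_ hb⟩
  have h1 := Phi_nonneg ζ hζ x
  have h2 : 0 ≤ gobj A b x := by unfold gobj; positivity
  have h3 : 0 ≤ ((ρ - L)/2) * (∑ i, (x i - y i) ^ 2) :=
    mul_nonneg (by linarith) (Finset.sum_nonneg fun i _ => sq_nonneg _)
  linarith
end
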